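/- There exists an infinitely differentiable function f : ℝ → ℝ and an interval [a₀, b₀] with a₀ < b₀ such that for every mean value abscissa c₀ ∈ (a₀, b₀) for f on [a₀, b₀], there is no δ > 0 and continuous function C : (b₀ - δ, b₀ + δ) → ℝ with C(b₀) = c₀ satisfying (f(b) - f(a₀))/(b - a₀) = f'(C(b)) for all b with |b - b₀| < δ. In other words, analyticity cannot be weakened to smoothness in the theorem guaranteeing a locally continuous choice of mean value abscissa. -/

import Mathlib

/-- Analyticity cannot be weakened to smoothness: there exist an infinitely
differentiable function `f : ℝ → ℝ` and an interval `[a₀, b₀]` such that no mean value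
abscissa `c₀ ∈ (a₀, b₀)` for `f` on `[a₀, b₀]` admits a locally continuous choice
`c = C(b)` of mean value abscissa near `b₀` with `C(b₀) = c₀`. -/
theorem smooth_counterexample_no_continuous_abscissa :
    ∃ f : ℝ → ℝ, ContDiff ℝ (⊤ : ℕ∞) f ∧
    ∃ a₀ b₀ : ℝ, a₀ < b₀ ∧
      ∀ c₀ ∈ Set.Ioo a₀ b₀,
        (f b₀ - f a₀) / (b₀ - a₀) = deriv f c₀ →
        ¬ ∃ δ > 0, ∃ C : ℝ → ℝ,
            ContinuousOn C (Set.Ioo (b₀ - δ) (b₀ + δ)) ∧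
            C b₀ = c₀ ∧
            ∀ b : ℝ, |b - b₀| < δ → (f b - f a₀) / (b - a₀) = deriv f (C b) := by
  refine ⟨expNegInvGlue, expNegInvGlue.contDiff, -1, 0, by norm_num, ?_⟩
  rintro c₀ ⟨_, hc⟩ _ ⟨δ, hδ, C, hC, hC0, h⟩
  have hd : ∀ x : ℝ, x < 0 → deriv expNegInvGlue x = 0 := by
    intro x hx
    have he : expNegInvGlue =ᶠ[nhds x] fun _ => (0 : ℝ) := by
      filter_upwards [Iio_mem_nhds hx] with y hy
      exact expNegInvGlue.zero_of_nonpos (le_of_lt hy)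
    rw [he.deriv_eq]
    simp
  have hcont : ContinuousAt C 0 :=
    hC.continuousAt (Ioo_mem_nhds (by linarith) (by linarith))
  have h1 : ∀ᶠ b in nhds (0 : ℝ), C b < 0 := by
    have : C 0 < 0 := by rw [hC0]; exact hc
    exact hcont.eventually (Iio_mem_nhds this)
  obtain ⟨ε, hε, hb⟩ := Metric.eventually_nhds_iff.1 h1
  have hm : 0 < min ε δ / 2 := by positivity
  have hmε : min ε δ / 2 < ε := by have := min_le_left ε δ; linarith
  have hmδ : min ε δ / 2 < δ := by have := min_le_right ε δ; linarith
  have hCb : C (min ε δ / 2) < 0 := by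
    apply hb
    rw [Real.dist_eq, sub_zero, abs_of_pos hm]
    exact hmε
  have h2 := h (min ε δ / 2) (by rw [sub_zero, abs_of_pos hm]; exact hmδ)
  rw [hd _ hCb, expNegInvGlue.zero_of_nonpos (by norm_num : (-1 : ℝ) ≤ 0)] at h2
  have h3 := expNegInvGlue.pos_of_pos hm
  have h4 : 0 < (expNegInvGlue (min ε δ / 2) - 0) / (min ε δ / 2 - -1) :=
    div_pos (by linarith) (by linarith)
  exact h4.ne' h2
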